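/- Under the following assumptions — (i) Θ is a compact subset of ℝ^d; (ii) the process (X_t)_{t≥1} is ergodic stationary; (iii) (S1) there exist C < ∞ and 0 < λ < 1 such that E[|ℓ_t(θ) − ℓ_{t,s}(θ)|²] ≤ C·λ^s for all 0 < s < t and all θ ∈ Θ; (iv) (R1) there exists K < ∞ such that |ℓ_t(θ) − ℓ_t(θ′)| ≤ K·‖θ − θ′‖ for every realization, every t ≥ 1 and all θ, θ′ ∈ Θ; (v) (R2) E[sup_{θ∈Θ} ℓ_t(θ)²] < ∞ for every t ≥ 1 — the limit L̄(θ) = lim_{T→∞} E[L_T(θ)] exists for every θ ∈ Θ, satisfies L̄(θ) = lim_{t→∞} E[ℓ_t(θ)], and sup_{θ∈Θ} |L_T(θ) − L̄(θ)| → 0 almost surely as T → ∞ (i.e. L_T converges to L̄ almost surely, uniformly in θ). -/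

import Mathlib

open MeasureTheory Filter

noncomputable section

/-- Left shift on the sequence space `ℕ → 𝒳`. -/
def seqShift {𝒳 : Type*} (x : ℕ → 𝒳) : ℕ → 𝒳 := fun n => x (n + 1)

/-- The log-likelihood at (0-based) time `t`:
`ℓ_{t+1}(θ) = g_{θ,t}(X_1, …, X_{t+1})`, i.e. it may use the whole past. -/
def ell {𝒳 Ω P : Type*} (X : ℕ → Ω → 𝒳)
    (g : P → (s : ℕ) → (Fin (s + 1) → 𝒳) → ℝ) (θ : P) (t : ℕ) (ω : Ω) : ℝ :=
  g θ t (fun i => X i ω)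

/-- The finite-memory approximation of the log-likelihood at (0-based) time `t`,
using only the `s` last observations together with the current one:
`ℓ_{t+1,s}(θ) = g_{θ,s}(X_{t+1-s}, …, X_{t+1})` (for `s ≤ t`). -/
def ellFM {𝒳 Ω P : Type*} (X : ℕ → Ω → 𝒳)
    (g : P → (s : ℕ) → (Fin (s + 1) → 𝒳) → ℝ) (θ : P) (s t : ℕ) (ω : Ω) : ℝ :=
  g θ s (fun i => X (t - s + i) ω)

/-- The average log-likelihood `L_T(θ) = (1/T) ∑_{t=1}^T ℓ_t(θ)`. -/
def avgLL {𝒳 Ω P : Type*} (X : ℕ → Ω → 𝒳)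
    (g : P → (s : ℕ) → (Fin (s + 1) → 𝒳) → ℝ) (θ : P) (T : ℕ) (ω : Ω) : ℝ :=
  (T : ℝ)⁻¹ * ∑ t ∈ Finset.range T, ell X g θ t ω

/-- The running maximum `max_{1 ≤ k ≤ n + 1} S_k` of the Birkhoff sums of `φ` along `f`, defined by
the recursion `M_{n+1} = φ + max 0 (M_n ∘ f)`. -/
def birkhoffMax {α : Type*} (f : α → α) (φ : α → ℝ) : ℕ → α → ℝ
  | 0 => φ
  | n + 1 => fun x => φ x + max 0 (birkhoffMax f φ n (f x))

lemma birkhoffMax_le_succ {α : Type*} (f : α → α) (φ : α → ℝ) (n : ℕ) (x : α) :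
    birkhoffMax f φ n x ≤ birkhoffMax f φ (n + 1) x := by
  induction n generalizing x with
  | zero => simp [birkhoffMax]
  | succ n ih =>
    have h := ih (f x)
    change φ x + max 0 (birkhoffMax f φ n (f x)) ≤ φ x + max 0 (birkhoffMax f φ (n + 1) (f x))
    gcongr

lemma birkhoffSum_succ_le_birkhoffMax {α : Type*} (f : α → α) (φ : α → ℝ) (n : ℕ) (x : α) :
    birkhoffSum f φ (n + 1) x ≤ birkhoffMax f φ n x := by
  induction n generalizing x with
  | zero => simp [birkhoffMax]
  | succ n ih =>
    rw [birkhoffSum_succ']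
    have := (ih (f x)).trans (le_max_right 0 _)
    simp only [birkhoffMax]
    linarith

lemma measurable_birkhoffMax {α : Type*} [MeasurableSpace α] {f : α → α} {φ : α → ℝ}
    (hf : Measurable f) (hφ : Measurable φ) (n : ℕ) : Measurable (birkhoffMax f φ n) := by
  induction n with
  | zero => exact hφ
  | succ n ih => exact hφ.add (measurable_const.max (ih.comp hf))

lemma integrable_birkhoffMax {α : Type*} [MeasurableSpace α] {ν : Measure α} {f : α → α}
    {φ : α → ℝ} (hf : MeasurePreserving f ν ν) (hφ : Integrable φ ν) (n : ℕ) :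
    Integrable (birkhoffMax f φ n) ν := by
  induction n with
  | zero => exact hφ
  | succ n ih =>
    have h : Integrable (birkhoffMax f φ n ∘ f) ν := hf.integrable_comp_of_integrable ih
    exact hφ.add ((integrable_zero _ _ _).sup h)

/-- If the mean of `φ` is negative, the Birkhoff sums of `φ` are a.e. bounded above. -/
lemma Ergodic.ae_bddAbove_birkhoffSum {α : Type*} [MeasurableSpace α] {ν : Measure α}
    {f : α → α} {φ : α → ℝ} (hf : Ergodic f ν) (hφm : Measurable φ) (hφ : Integrable φ ν)
    (hneg : ∫ x, φ x ∂ν < 0) :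
    ∀ᵐ x ∂ν, ∃ B : ℝ, ∀ n, birkhoffSum f φ n x ≤ B := by
  set M := birkhoffMax f φ with hM
  have hMint : ∀ n, Integrable (M n) ν := integrable_birkhoffMax hf.toMeasurePreserving hφ
  have hmono : ∀ x, Monotone fun n => M n x := fun x =>
    monotone_nat_of_le_succ fun n => birkhoffMax_le_succ f φ n x
  have hrec : ∀ n x, M (n + 1) x = φ x + max 0 (M n (f x)) := fun _ _ => rfl
  set A : Set α := {x | ∀ k : ℕ, ∃ n, (k : ℝ) < M n x} with hA
  have hAm : MeasurableSet A := by
    simp only [hA, Set.ofPred_forall, Set.ofPred_exists]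
    exact MeasurableSet.iInter fun k => MeasurableSet.iUnion fun n =>
      measurableSet_lt measurable_const (measurable_birkhoffMax hf.measurable hφm n)
  have hAinv : f ⁻¹' A = A := by
    ext x
    simp only [hA, Set.mem_preimage, Set.mem_ofPred_eq]
    constructor
    · intro h k
      obtain ⟨k', hk'⟩ := exists_nat_gt ((k : ℝ) - φ x)
      obtain ⟨n, hn⟩ := h k'
      refine ⟨n + 1, ?_⟩
      rw [hrec]
      linarith [le_max_right 0 (M n (f x))]
    · intro h k
      obtain ⟨k', hk'⟩ := exists_nat_gt ((k : ℝ) + φ x)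
      obtain ⟨l, hl⟩ := exists_nat_gt (φ x)
      obtain ⟨n, hn⟩ := h (max k' l)
      refine ⟨n, ?_⟩
      have h1 := hn.trans_le (birkhoffMax_le_succ f φ n x)
      have h2 : φ x + max 0 (M n (f x)) > max (k' : ℝ) l := by
        rw [← hrec]; exact_mod_cast h1
      rcases max_cases 0 (M n (f x)) with ⟨h3, -⟩ | ⟨h3, -⟩
      · linarith [le_max_right (k' : ℝ) l]
      · linarith [le_max_left (k' : ℝ) l]
  rcases hf.toPreErgodic.ae_mem_or_ae_notMem hAm hAinv with h | h
  · exfalso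
    have hlim : Tendsto (fun n => ∫ x, (φ x - min 0 (M n (f x))) ∂ν) atTop
        (nhds (∫ x, φ x ∂ν)) := by
      have hφf : Integrable (φ ∘ f) ν := hf.toMeasurePreserving.integrable_comp_of_integrable hφ
      refine tendsto_integral_of_dominated_convergence (fun x => |φ x| + |φ (f x)|) ?_
        (hφ.abs.add hφf.abs) ?_ ?_
      · intro n
        exact (hφm.sub (measurable_const.min
          ((measurable_birkhoffMax hf.measurable hφm n).comp
            hf.measurable))).aestronglyMeasurable
      · refine fun n => Eventually.of_forall fun x => ?_
        have h0 : φ (f x) ≤ M n (f x) := hmono (f x) (Nat.zero_le n)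
        have h1 : |min 0 (M n (f x))| ≤ |φ (f x)| := by
          rw [abs_of_nonpos (min_le_left _ _)]
          rcases min_cases 0 (M n (f x)) with ⟨h3, -⟩ | ⟨h3, -⟩ <;> rw [h3]
          · simp
          · linarith [neg_abs_le (φ (f x))]
        rw [Real.norm_eq_abs]
        exact (abs_sub _ _).trans (by gcongr)
      · filter_upwards [h] with x hx
        have hx' : f x ∈ A := by rw [← hAinv] at hx; exact hx
        obtain ⟨n, hn⟩ := hx' 0
        refine tendsto_const_nhds.congr' ?_
        filter_upwards [eventually_ge_atTop n] with m hm
        have : M n (f x) ≤ M m (f x) := hmono (f x) hm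
        rw [min_eq_left (by push_cast at hn; linarith), sub_zero]
    have hnonneg : ∀ n, 0 ≤ ∫ x, (φ x - min 0 (M n (f x))) ∂ν := by
      intro n
      have h1 : ∀ x, φ x - min 0 (M n (f x)) = M (n + 1) x - M n (f x) := by
        intro x
        rw [hrec]
        linarith [min_add_max 0 (M n (f x))]
      have h2 : Integrable (fun x => M n (f x)) ν :=
        hf.toMeasurePreserving.integrable_comp_of_integrable (hMint n)
      have h3 : ∫ x, M n (f x) ∂ν = ∫ x, M n x ∂ν := by
        rw [← integral_map hf.measurable.aemeasurable, hf.map_eq]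
        rw [hf.map_eq]
        exact (hMint n).aestronglyMeasurable
      simp_rw [h1]
      rw [integral_sub (hMint _) h2, h3, sub_nonneg]
      exact integral_mono (hMint n) (hMint (n + 1)) fun x => birkhoffMax_le_succ f φ n x
    exact absurd (ge_of_tendsto' hlim hnonneg) (not_le.mpr hneg)
  · filter_upwards [h] with x hx
    simp only [hA, Set.mem_ofPred_eq, not_forall, not_exists, not_lt] at hx
    obtain ⟨k, hk⟩ := hx
    refine ⟨k, fun n => ?_⟩
    cases n with
    | zero => simp
    | succ n => exact (birkhoffSum_succ_le_birkhoffMax f φ n x).trans (hk n)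

/-- Upper half of the pointwise ergodic theorem. -/
lemma Ergodic.ae_eventually_birkhoffAverage_le {α : Type*} [MeasurableSpace α] {ν : Measure α}
    [IsProbabilityMeasure ν] {f : α → α} {φ : α → ℝ} (hf : Ergodic f ν) (hφm : Measurable φ)
    (hφ : Integrable φ ν) {ε : ℝ} (hε : 0 < ε) :
    ∀ᵐ x ∂ν, ∀ᶠ n in atTop, birkhoffAverage ℝ f φ n x ≤ ∫ y, φ y ∂ν + ε := by
  set c := ∫ y, φ y ∂ν + ε / 2 with hc
  have h := hf.ae_bddAbove_birkhoffSum (φ := fun x => φ x - c) (hφm.sub_const c)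
    (hφ.sub (integrable_const c)) (by
      rw [integral_sub hφ (integrable_const c)]
      simp [hc, hε])
  filter_upwards [h] with x ⟨B, hB⟩
  have hlim : Tendsto (fun n : ℕ => B / (n : ℝ)) atTop (nhds 0) :=
    tendsto_const_div_atTop_nhds_zero_nat B
  filter_upwards [hlim.eventually_lt_const (half_pos hε), eventually_gt_atTop 0] with n hn hn0
  have hn0' : (0 : ℝ) < n := by exact_mod_cast hn0
  have h1 := hB n
  simp only [birkhoffSum, Finset.sum_sub_distrib, Finset.sum_const, Finset.card_range,
    nsmul_eq_mul] at h1
  rw [birkhoffAverage, birkhoffSum, smul_eq_mul, inv_mul_le_iff₀ hn0']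
  rw [div_lt_iff₀ hn0'] at hn
  have : ∫ y, φ y ∂ν = c - ε / 2 := by rw [hc]; ring
  rw [this]
  nlinarith

/-- **Birkhoff's pointwise ergodic theorem** for ergodic maps of a probability space. -/
theorem Ergodic.ae_tendsto_birkhoffAverage {α : Type*} [MeasurableSpace α] {ν : Measure α}
    [IsProbabilityMeasure ν] {f : α → α} {φ : α → ℝ} (hf : Ergodic f ν) (hφm : Measurable φ)
    (hφ : Integrable φ ν) :
    ∀ᵐ x ∂ν, Tendsto (fun n => birkhoffAverage ℝ f φ n x) atTop (nhds (∫ y, φ y ∂ν)) := by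
  have hpos : ∀ k : ℕ, (0 : ℝ) < 1 / ((k : ℝ) + 1) := fun k => Nat.one_div_pos_of_nat
  have h1 := ae_all_iff.mpr fun k : ℕ => hf.ae_eventually_birkhoffAverage_le hφm hφ (hpos k)
  have h2 := ae_all_iff.mpr fun k : ℕ =>
    hf.ae_eventually_birkhoffAverage_le hφm.neg hφ.neg (hpos k)
  filter_upwards [h1, h2] with x hx1 hx2
  rw [Metric.tendsto_atTop']
  intro ε hε
  obtain ⟨k, hk⟩ := exists_nat_one_div_lt hε
  obtain ⟨N, hN⟩ := eventually_atTop.mp ((hx1 k).and (hx2 k))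
  refine ⟨N, fun n hn => ?_⟩
  obtain ⟨h3, h4⟩ := hN n hn.le
  rw [birkhoffAverage_neg] at h4
  simp only [Pi.neg_apply, integral_neg] at h4
  rw [Real.dist_eq, abs_lt]
  constructor <;> linarith

/-- A dominated convergence theorem for growing sums `∑ j < T, a j T` with a dominating family
`b j T` that varies with `T` and loses no mass in the limit. -/
lemma tendsto_sum_range_of_dominated {a b : ℕ → ℕ → ℝ} {α β : ℕ → ℝ} {B : ℕ → ℝ}
    (ha : ∀ j, Tendsto (a j) atTop (nhds (α j))) (hb : ∀ j, Tendsto (b j) atTop (nhds (β j)))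
    (hab : ∀ j T, |a j T| ≤ b j T) (hβ : Summable β) (hα : Summable α)
    (hbB : ∀ T, ∑ j ∈ Finset.range T, b j T ≤ B T) (hB : Tendsto B atTop (nhds (∑' j, β j))) :
    Tendsto (fun T => ∑ j ∈ Finset.range T, a j T) atTop (nhds (∑' j, α j)) := by
  rw [Metric.tendsto_atTop']
  intro ε hε
  have hε' : 0 < ε / 6 := by positivity
  obtain ⟨s, hs1, hs2⟩ := ((Metric.tendsto_nhds.mp hβ.hasSum.tendsto_sum_nat _ hε').and
    (Metric.tendsto_nhds.mp hα.hasSum.tendsto_sum_nat _ hε')).exists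
  have hsa := tendsto_finsetSum (Finset.range s) fun j _ => ha j
  have hsb := tendsto_finsetSum (Finset.range s) fun j _ => hb j
  obtain ⟨N, hN⟩ := eventually_atTop.mp ((Metric.tendsto_nhds.mp hsa _ hε').and
    ((Metric.tendsto_nhds.mp hsb _ hε').and ((Metric.tendsto_nhds.mp hB _ hε').and
      (eventually_ge_atTop s))))
  refine ⟨N, fun T hT => ?_⟩
  obtain ⟨h1, h2, h3, hsT⟩ := hN T hT.le
  have h4 : |∑ j ∈ Finset.range T, a j T - ∑ j ∈ Finset.range s, a j T| ≤
      ∑ j ∈ Finset.range T, b j T - ∑ j ∈ Finset.range s, b j T := by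
    rw [← Finset.sum_Ico_eq_sub _ hsT, ← Finset.sum_Ico_eq_sub _ hsT]
    exact (Finset.abs_sum_le_sum_abs _ _).trans (Finset.sum_le_sum fun j _ => hab j T)
  have h5 := hbB T
  rw [Real.dist_eq, abs_lt] at *
  rw [abs_le] at h4
  constructor <;> linarith

/-- Ergodic theorem for the triangular array `∑ j ≤ t, e j (f^[t - j] x)`, where the functions
`e j` are absolutely summable in `L¹`. -/
lemma Ergodic.ae_tendsto_average_sum_range {α : Type*} [MeasurableSpace α] {ν : Measure α}
    [IsProbabilityMeasure ν] {f : α → α} (hf : Ergodic f ν) {e : ℕ → α → ℝ}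
    (hem : ∀ j, Measurable (e j)) (he : ∀ j, Integrable (e j) ν)
    (hsum : Summable fun j => ∫ x, |e j x| ∂ν) :
    ∀ᵐ x ∂ν, Tendsto (fun T : ℕ => (T : ℝ)⁻¹ * ∑ t ∈ Finset.range T,
      ∑ j ∈ Finset.range (t + 1), e j (f^[t - j] x)) atTop (nhds (∑' j, ∫ y, e j y ∂ν)) := by
  have hlint : ∫⁻ x, ∑' j, ENNReal.ofReal |e j x| ∂ν ≠ ⊤ := by
    rw [lintegral_tsum fun j => (hem j).abs.ennreal_ofReal.aemeasurable]
    simp_rw [← ofReal_integral_eq_lintegral_ofReal (he _).abs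
      (Eventually.of_forall fun x => abs_nonneg _)]
    rw [← ENNReal.ofReal_tsum_of_nonneg (fun j => integral_nonneg fun x => abs_nonneg _) hsum]
    exact ENNReal.ofReal_ne_top
  have hmeas : Measurable fun x => ∑' j, ENNReal.ofReal |e j x| :=
    Measurable.tsum fun j => (hem j).abs.ennreal_ofReal
  have hFeq : (fun x => (∑' j, ENNReal.ofReal |e j x|).toReal) = fun x => ∑' j, |e j x| := by
    ext x
    rw [ENNReal.tsum_toReal_eq fun j => ENNReal.ofReal_ne_top]
    simp_rw [ENNReal.toReal_ofReal (abs_nonneg _)]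
  have hFm : Measurable fun x => ∑' j, |e j x| := hFeq ▸ hmeas.ennreal_toReal
  have hFi : Integrable (fun x => ∑' j, |e j x|) ν :=
    hFeq ▸ integrable_toReal_of_lintegral_ne_top hmeas.aemeasurable hlint
  have hsm : ∀ᵐ x ∂ν, Summable fun j => |e j x| := by
    filter_upwards [ae_lt_top hmeas hlint] with x hx
    have := ENNReal.summable_toReal hx.ne
    simpa only [ENNReal.toReal_ofReal (abs_nonneg _)] using this
  have hsm' : ∀ᵐ x ∂ν, ∀ u : ℕ, Summable fun j => |e j (f^[u] x)| :=
    ae_all_iff.mpr fun u => (hf.toMeasurePreserving.iterate u).quasiMeasurePreserving.ae hsm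
  have hFint : ∑' j, ∫ x, |e j x| ∂ν = ∫ x, ∑' j, |e j x| ∂ν :=
    integral_tsum_of_summable_integral_norm (F := fun j x => |e j x|) (fun j => (he j).abs)
      (by simpa using hsum)
  have h1 := ae_all_iff.mpr fun j => hf.ae_tendsto_birkhoffAverage (hem j) (he j)
  have h2 := ae_all_iff.mpr fun j => hf.ae_tendsto_birkhoffAverage (hem j).abs (he j).abs
  filter_upwards [hsm', h1, h2, hf.ae_tendsto_birkhoffAverage hFm hFi] with x hx hx1 hx2 hx3
  rw [← hFint] at hx3
  have hkey : ∀ T : ℕ, (T : ℝ)⁻¹ * ∑ t ∈ Finset.range T,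
      ∑ j ∈ Finset.range (t + 1), e j (f^[t - j] x) =
      ∑ j ∈ Finset.range T, (T : ℝ)⁻¹ * birkhoffSum f (e j) (T - j) x := fun T => by
    rw [← Finset.mul_sum, Finset.sum_range_diag_flip T fun j u => e j (f^[u] x)]
    rfl
  simp_rw [hkey]
  refine tendsto_sum_range_of_dominated
    (b := fun j T => birkhoffAverage ℝ f (fun y => |e j y|) T x)
    (B := fun T => birkhoffAverage ℝ f (fun y => ∑' j, |e j y|) T x)
    (fun j => ?_) hx2 (fun j T => ?_) hsum ?_ (fun T => ?_) hx3
  · rw [← tendsto_add_atTop_iff_nat j]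
    have h := (tendsto_natCast_div_add_atTop (j : ℝ)).mul (hx1 j)
    rw [one_mul] at h
    refine h.congr fun T => ?_
    rw [birkhoffAverage, smul_eq_mul, Nat.add_sub_cancel]
    rcases Nat.eq_zero_or_pos T with rfl | hT
    · simp
    · have hT' : (T : ℝ) ≠ 0 := by positivity
      push_cast
      field_simp
  · rw [birkhoffAverage, smul_eq_mul, abs_mul, abs_of_nonneg (by positivity : (0 : ℝ) ≤ (T : ℝ)⁻¹)]
    refine mul_le_mul_of_nonneg_left ?_ (by positivity)
    refine (Finset.abs_sum_le_sum_abs _ _).trans ?_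
    exact Finset.sum_le_sum_of_subset_of_nonneg
      (Finset.range_subset_range.mpr (Nat.sub_le T j)) fun _ _ _ => abs_nonneg _
  · exact hsum.of_norm_bounded fun j => norm_integral_le_integral_norm _
  · simp only [birkhoffAverage, birkhoffSum, smul_eq_mul]
    rw [← Finset.mul_sum, Finset.sum_comm]
    refine mul_le_mul_of_nonneg_left (Finset.sum_le_sum fun u _ => ?_) (by positivity)
    exact (hx u).sum_le_tsum _ fun _ _ => abs_nonneg _

/-- The innovation `Y_j(x_0, …, x_j) - Y_{j-1}(x_1, …, x_j)` gained by looking one step further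
into the past. -/
def memoryIncrement {𝒳 : Type*} (G : (s : ℕ) → (Fin (s + 1) → 𝒳) → ℝ) :
    ℕ → (ℕ → 𝒳) → ℝ
  | 0 => fun x => G 0 fun i => x i
  | j + 1 => fun x => G (j + 1) (fun i => x i) - G j (fun i => seqShift x i)

lemma seqShift_iterate_apply {𝒳 : Type*} (k n : ℕ) (x : ℕ → 𝒳) :
    seqShift^[k] x n = x (n + k) := by
  induction k generalizing x with
  | zero => rfl
  | succ k ih => rw [Function.iterate_succ_apply, ih]; simp [seqShift, add_assoc]

lemma sum_memoryIncrement {𝒳 : Type*} (G : (s : ℕ) → (Fin (s + 1) → 𝒳) → ℝ) (t : ℕ)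
    (x : ℕ → 𝒳) :
    ∑ j ∈ Finset.range (t + 1), memoryIncrement G j (seqShift^[t - j] x) =
      G t fun i => x i := by
  set h : ℕ → ℝ := fun k => G k fun i => seqShift^[t - k] x i with hh
  have h1 : ∀ j ∈ Finset.range t,
      memoryIncrement G (j + 1) (seqShift^[t - (j + 1)] x) = h (j + 1) - h j := by
    intro j hj
    have : t - j = t - (j + 1) + 1 := by have := Finset.mem_range.mp hj; omega
    simp only [hh, memoryIncrement, this, Function.iterate_succ_apply']
  rw [Finset.sum_range_succ', Finset.sum_congr rfl h1, Finset.sum_range_sub]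
  simp [hh, memoryIncrement]

lemma measurable_seqShift {𝒳 : Type*} [MeasurableSpace 𝒳] :
    Measurable (seqShift : (ℕ → 𝒳) → ℕ → 𝒳) :=
  measurable_pi_lambda _ fun n => measurable_pi_apply (n + 1)

lemma measurable_memoryIncrement {𝒳 : Type*} [MeasurableSpace 𝒳]
    {G : (s : ℕ) → (Fin (s + 1) → 𝒳) → ℝ} (hG : ∀ s, Measurable (G s)) (j : ℕ) :
    Measurable (memoryIncrement G j) := by
  have h : ∀ s, Measurable fun x : ℕ → 𝒳 => G s fun i => x i := fun s =>
    (hG s).comp (measurable_pi_lambda _ fun i => measurable_pi_apply _)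
  cases j with
  | zero => exact h 0
  | succ j => exact (h (j + 1)).sub ((h j).comp measurable_seqShift)

/-- An `L¹` bound from an `L²` bound. -/
lemma integrable_and_integral_abs_le_of_lintegral_sq_le {Ω : Type*} [MeasurableSpace Ω]
    {μ : Measure Ω} [IsProbabilityMeasure μ] {Z : Ω → ℝ} (hZ : Measurable Z) {c : ℝ} (hc : 0 ≤ c)
    (h : ∫⁻ ω, ENNReal.ofReal (|Z ω| ^ 2) ∂μ ≤ ENNReal.ofReal c) :
    Integrable Z μ ∧ ∫ ω, |Z ω| ∂μ ≤ √c := by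
  have h2 : MemLp Z 2 μ := by
    rw [memLp_two_iff_integrable_sq hZ.aestronglyMeasurable]
    refine ⟨(hZ.pow_const 2).aestronglyMeasurable, ?_⟩
    rw [hasFiniteIntegral_iff_ofReal (Eventually.of_forall fun ω => sq_nonneg _)]
    simp_rw [sq_abs] at h
    exact h.trans_lt ENNReal.ofReal_lt_top
  refine ⟨h2.integrable one_le_two, ?_⟩
  have h3 : ∫ ω, |Z ω| ^ 2 ∂μ ≤ c := by
    rw [integral_eq_lintegral_of_nonneg_ae (Eventually.of_forall fun ω => by positivity)
      (hZ.abs.pow_const 2).aestronglyMeasurable]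
    exact ENNReal.toReal_le_of_le_ofReal hc h
  have h4 : (∫ ω, |Z ω| ∂μ) ^ 2 ≤ ∫ ω, |Z ω| ^ 2 ∂μ := by
    have := ProbabilityTheory.variance_nonneg |Z| μ
    rw [ProbabilityTheory.variance_eq_sub h2.abs] at this
    simpa using this
  exact Real.le_sqrt_of_sq_le (h4.trans h3)

/-- Convergence of the average log-likelihood at a fixed parameter. -/
lemma tendsto_avgLL_of_finiteMemory {𝒳 : Type*} [MeasurableSpace 𝒳] {Ω P : Type*}
    [MeasurableSpace Ω] {μ : Measure Ω} [IsProbabilityMeasure μ] {X : ℕ → Ω → 𝒳}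
    (hXmeas : ∀ t, Measurable (X t)) {g : P → (s : ℕ) → (Fin (s + 1) → 𝒳) → ℝ} {θ : P}
    (hgmeas : ∀ s, Measurable (g θ s))
    (hErg : Ergodic seqShift (Measure.map (fun ω n => X n ω) μ))
    {C lam : ℝ} (hlam0 : 0 < lam) (hlam1 : lam < 1)
    (hS1 : ∀ t s : ℕ, 0 < s → s ≤ t →
      ∫⁻ ω, ENNReal.ofReal (|ell X g θ t ω - ellFM X g θ s t ω| ^ 2) ∂μ
        ≤ ENNReal.ofReal (C * lam ^ s))
    (hellInt : ∀ t, Integrable (ell X g θ t) μ) :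
    ∃ L : ℝ, Tendsto (fun T : ℕ => ∫ ω, avgLL X g θ T ω ∂μ) atTop (nhds L) ∧
      Tendsto (fun t : ℕ => ∫ ω, ell X g θ t ω ∂μ) atTop (nhds L) ∧
      ∀ᵐ ω ∂μ, Tendsto (fun T : ℕ => avgLL X g θ T ω) atTop (nhds L) := by
  set ν := Measure.map (fun ω n => X n ω) μ
  have hXm : Measurable fun ω n => X n ω := measurable_pi_lambda _ hXmeas
  have : IsProbabilityMeasure ν := Measure.isProbabilityMeasure_map hXm.aemeasurable
  set e := memoryIncrement (g θ) with he
  have hem : ∀ j, Measurable (e j) := measurable_memoryIncrement hgmeas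
  have hYm : ∀ s, Measurable fun x : ℕ → 𝒳 => g θ s fun i => x i := fun s =>
    (hgmeas s).comp (measurable_pi_lambda _ fun i => measurable_pi_apply _)
  have hYi : ∀ s, Integrable (fun x : ℕ → 𝒳 => g θ s fun i => x i) ν := fun s =>
    (integrable_map_measure (hYm s).aestronglyMeasurable hXm.aemeasurable).mpr (hellInt s)
  have hei : ∀ j, Integrable (e j) ν := by
    rintro (_ | j)
    · exact hYi 0
    · exact (hYi (j + 1)).sub (hErg.toMeasurePreserving.integrable_comp_of_integrable (hYi j))
  have hbound : ∀ j, ∫ x, |e (j + 2) x| ∂ν ≤ √(max C 0 * lam ^ (j + 1)) := by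
    intro j
    have hc : 0 ≤ max C 0 * lam ^ (j + 1) := by positivity
    have h := hS1 (j + 2) (j + 1) (by omega) (by omega)
    have heq : ∀ ω, ell X g θ (j + 2) ω - ellFM X g θ (j + 1) (j + 2) ω =
        e (j + 2) fun n => X n ω := by
      intro ω
      have : j + 2 - (j + 1) = 1 := by omega
      simp only [ell, ellFM, he, memoryIncrement, seqShift, this, add_comm 1]
    simp_rw [heq] at h
    rw [integral_map hXm.aemeasurable (hem _).abs.aestronglyMeasurable]
    exact (integrable_and_integral_abs_le_of_lintegral_sq_le ((hem (j + 2)).comp hXm) hc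
      (h.trans (ENNReal.ofReal_le_ofReal (by gcongr; exact le_max_left _ _)))).2
  have hsum : Summable fun j => ∫ x, |e j x| ∂ν := by
    rw [← summable_nat_add_iff 2]
    refine Summable.of_nonneg_of_le (fun j => integral_nonneg fun x => abs_nonneg _) hbound ?_
    have hsq : ∀ j : ℕ, √(max C 0 * lam ^ (j + 1)) = √(max C 0) * √lam * √lam ^ j := by
      intro j
      rw [Real.sqrt_mul (le_max_right _ _), pow_succ, Real.sqrt_mul (by positivity),
        Real.sqrt_eq_rpow (lam ^ j), Real.sqrt_eq_rpow lam, ← Real.rpow_natCast,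
        ← Real.rpow_natCast, ← Real.rpow_mul hlam0.le, ← Real.rpow_mul hlam0.le,
        mul_comm (j : ℝ)]
      ring
    simp_rw [hsq]
    refine (summable_geometric_of_lt_one (Real.sqrt_nonneg _) ?_).mul_left _
    rw [Real.sqrt_lt' one_pos]
    simpa using hlam1
  have hell : Tendsto (fun t : ℕ => ∫ ω, ell X g θ t ω ∂μ) atTop
      (nhds (∑' j, ∫ y, e j y ∂ν)) := by
    have hs : Summable fun j => ∫ y, e j y ∂ν :=
      hsum.of_norm_bounded fun j => norm_integral_le_integral_norm _
    refine ((tendsto_add_atTop_iff_nat 1).mpr hs.hasSum.tendsto_sum_nat).congr fun t => ?_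
    have h1 : ∫ ω, ell X g θ t ω ∂μ = ∫ x, g θ t (fun i => x i) ∂ν :=
      (integral_map hXm.aemeasurable (hYm t).aestronglyMeasurable).symm
    have hmp : ∀ k, MeasurePreserving seqShift^[k] ν ν :=
      fun k => hErg.toMeasurePreserving.iterate k
    have h2 : ∀ j k, ∫ x, e j (seqShift^[k] x) ∂ν = ∫ x, e j x ∂ν := by
      intro j k
      conv_rhs => rw [← (hmp k).map_eq]
      exact (integral_map (hmp k).aemeasurable (hem j).aestronglyMeasurable).symm
    simp_rw [h1, ← sum_memoryIncrement]
    refine Eq.trans ?_ (integral_finsetSum _ fun j _ =>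
      (hmp _).integrable_comp_of_integrable (hei j)).symm
    exact Finset.sum_congr rfl fun j _ => (h2 j _).symm
  refine ⟨_, ?_, hell, ?_⟩
  · refine hell.cesaro.congr fun T => ?_
    simp only [avgLL]
    rw [integral_const_mul, integral_finsetSum _ fun t _ => hellInt t]
  · filter_upwards [ae_of_ae_map hXm.aemeasurable
      (hErg.ae_tendsto_average_sum_range hem hei hsum)] with ω hω
    simp_rw [he, sum_memoryIncrement] at hω
    exact hω

/-- Pointwise convergence of uniformly Lipschitz functions on a dense subset of a compact set
is uniform on that set. -/
lemma IsCompact.tendsto_biSup_abs_sub_of_lipschitz {P : Type*} [PseudoMetricSpace P]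
    {Θ D : Set P} (hΘ : IsCompact Θ) (hDΘ : D ⊆ Θ) (hD : Θ ⊆ closure D)
    {F : ℕ → P → ℝ} {L : P → ℝ} {K : ℝ} (hK : 0 ≤ K)
    (hF : ∀ T, ∀ θ ∈ Θ, ∀ θ' ∈ Θ, |F T θ - F T θ'| ≤ K * dist θ θ')
    (hL : ∀ θ ∈ Θ, ∀ θ' ∈ Θ, |L θ - L θ'| ≤ K * dist θ θ')
    (hlim : ∀ θ ∈ D, Tendsto (fun T => F T θ) atTop (nhds (L θ))) :
    Tendsto (fun T => ⨆ θ ∈ Θ, |F T θ - L θ|) atTop (nhds 0) := by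
  rw [Metric.tendsto_nhds]
  intro ε hε
  have hδ : 0 < ε / (4 * (K + 1)) := by positivity
  obtain ⟨N, hND, hNfin, hN⟩ := hΘ.elim_finite_subcover_image (b := D)
    (c := fun θ => Metric.ball θ (ε / (4 * (K + 1)))) (fun _ _ => Metric.isOpen_ball) (by
      intro θ hθ
      obtain ⟨θ', hθ', h⟩ := Metric.mem_closure_iff.mp (hD hθ) _ hδ
      exact Set.mem_biUnion hθ' h)
  have hev : ∀ᶠ T in atTop, ∀ θ ∈ N, dist (F T θ) (L θ) < ε / 4 :=
    (eventually_all_finite hNfin).mpr fun θ hθ =>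
      Metric.tendsto_nhds.mp (hlim θ (hND hθ)) _ (by positivity)
  filter_upwards [hev] with T hT
  have hle : ⨆ θ ∈ Θ, |F T θ - L θ| ≤ 3 * ε / 4 := by
    refine Real.iSup_le (fun θ => Real.iSup_le (fun hθ => ?_) (by positivity)) (by positivity)
    obtain ⟨θ', hθ', hdist⟩ := Set.mem_iUnion₂.mp (hN hθ)
    have hθ'Θ := hDΘ (hND hθ')
    have h1 : K * dist θ θ' ≤ ε / 4 := by
      have h2 := (Metric.mem_ball.mp hdist).le
      rw [le_div_iff₀ (by positivity)] at h2
      nlinarith [dist_nonneg (x := θ) (y := θ')]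
    have h3 := abs_le.mp ((hF T θ hθ θ' hθ'Θ).trans h1)
    have h4 := abs_le.mp ((hL θ hθ θ' hθ'Θ).trans h1)
    have h5 := hT θ' hθ'
    rw [Real.dist_eq, abs_lt] at h5
    rw [abs_le]
    constructor <;> linarith [h3.1, h3.2, h4.1, h4.2, h5.1, h5.2]
  have hnonneg : 0 ≤ ⨆ θ ∈ Θ, |F T θ - L θ| :=
    Real.iSup_nonneg fun θ => Real.iSup_nonneg fun _ => abs_nonneg _
  rw [Real.dist_eq, sub_zero, abs_of_nonneg hnonneg]
  linarith

lemma le_biSup_sq_of_lipschitz {P : Type*} [PseudoMetricSpace P] {Θ : Set P}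
    (hΘ : Bornology.IsBounded Θ) {h : P → ℝ} {K : ℝ} (hK : 0 ≤ K)
    (hh : ∀ θ ∈ Θ, ∀ θ' ∈ Θ, |h θ - h θ'| ≤ K * dist θ θ') {θ : P} (hθ : θ ∈ Θ) :
    h θ ^ 2 ≤ ⨆ θ' ∈ Θ, h θ' ^ 2 := by
  have hbdd : BddAbove (Set.range fun θ' => ⨆ _ : θ' ∈ Θ, h θ' ^ 2) := by
    refine ⟨(|h θ| + K * Metric.diam Θ) ^ 2, ?_⟩
    rintro _ ⟨θ', rfl⟩
    refine Real.iSup_le (fun hθ' => ?_) (sq_nonneg _)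
    have h1 : |h θ' - h θ| ≤ K * Metric.diam Θ :=
      (hh θ' hθ' θ hθ).trans
        (mul_le_mul_of_nonneg_left (Metric.dist_le_diam_of_mem hΘ hθ' hθ) hK)
    rw [← sq_abs (h θ')]
    gcongr
    linarith [abs_sub_abs_le_abs_sub (h θ') (h θ)]
  calc h θ ^ 2 = ⨆ _ : θ ∈ Θ, h θ ^ 2 := (ciSup_pos (f := fun _ : θ ∈ Θ => h θ ^ 2) hθ).symm
    _ ≤ _ := le_ciSup hbdd θ

theorem convergence_of_average_log_likelihood
    {𝒳 : Type*} [MeasurableSpace 𝒳] {Ω : Type*} [MeasurableSpace Ω]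
    (μ : Measure Ω) [IsProbabilityMeasure μ] {d : ℕ}
    -- (i) Θ is a compact subset of ℝ^d
    (Θ : Set (EuclideanSpace ℝ (Fin d))) (hΘc : IsCompact Θ) (hΘne : Θ.Nonempty)
    -- the process and the log-likelihood structure
    (X : ℕ → Ω → 𝒳) (hXmeas : ∀ t, Measurable (X t))
    (g : EuclideanSpace ℝ (Fin d) → (s : ℕ) → (Fin (s + 1) → 𝒳) → ℝ)
    (hgmeas : ∀ θ s, Measurable (g θ s))
    -- (ii) ergodic stationarity: the law of the process on the sequence space is
    -- invariant and ergodic under the left shift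
    (hErg : Ergodic seqShift (Measure.map (fun ω n => X n ω) μ))
    -- (iii) (S1) finite-memory approximability, uniformly over `Θ`
    (C lam : ℝ) (hlam0 : 0 < lam) (hlam1 : lam < 1)
    (hS1 : ∀ θ ∈ Θ, ∀ t s : ℕ, 0 < s → s ≤ t →
      ∫⁻ ω, ENNReal.ofReal (|ell X g θ t ω - ellFM X g θ s t ω| ^ 2) ∂μ
        ≤ ENNReal.ofReal (C * lam ^ s))
    -- (iv) (R1) Lipschitz continuity in the parameter, for every realization
    (K : ℝ)
    (hR1 : ∀ (t : ℕ) (ω : Ω), ∀ θ ∈ Θ, ∀ θ' ∈ Θ,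
      |ell X g θ t ω - ell X g θ' t ω| ≤ K * ‖θ - θ'‖)
    -- (v) (R2) dominance: `E[sup_{θ∈Θ} ℓ_t(θ)²] < ∞`
    (hR2 : ∀ t : ℕ,
      ∫⁻ ω, ENNReal.ofReal (⨆ θ ∈ Θ, (ell X g θ t ω) ^ 2) ∂μ < ⊤) :
    -- conclusion: the limit `L̄` exists, equals `lim_t E[ℓ_t(θ)]`, and
    -- `L_T → L̄` almost surely, uniformly in `θ`
    ∃ Lbar : EuclideanSpace ℝ (Fin d) → ℝ,
      (∀ θ ∈ Θ, Tendsto (fun T : ℕ => ∫ ω, avgLL X g θ T ω ∂μ) atTop (nhds (Lbar θ))) ∧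
      (∀ θ ∈ Θ, Tendsto (fun t : ℕ => ∫ ω, ell X g θ t ω ∂μ) atTop (nhds (Lbar θ))) ∧
      (∀ᵐ ω ∂μ, Tendsto (fun T : ℕ => ⨆ θ ∈ Θ, |avgLL X g θ T ω - Lbar θ|)
        atTop (nhds 0)) := by
  have hK : ∀ (t : ℕ) (ω : Ω), ∀ θ ∈ Θ, ∀ θ' ∈ Θ,
      |ell X g θ t ω - ell X g θ' t ω| ≤ max K 0 * dist θ θ' := by
    intro t ω θ hθ θ' hθ'
    rw [dist_eq_norm]
    exact (hR1 t ω θ hθ θ' hθ').trans (by gcongr; exact le_max_left _ _)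
  have hellm : ∀ θ t, Measurable (ell X g θ t) := fun θ t =>
    (hgmeas θ t).comp (measurable_pi_lambda _ fun i => hXmeas i)
  have hellInt : ∀ θ ∈ Θ, ∀ t, Integrable (ell X g θ t) μ := by
    intro θ hθ t
    have h2 : MemLp (ell X g θ t) 2 μ := by
      rw [memLp_two_iff_integrable_sq (hellm θ t).aestronglyMeasurable]
      refine ⟨((hellm θ t).pow_const 2).aestronglyMeasurable, ?_⟩
      rw [hasFiniteIntegral_iff_ofReal (Eventually.of_forall fun ω => sq_nonneg _)]
      refine (lintegral_mono fun ω => ENNReal.ofReal_le_ofReal ?_).trans_lt (hR2 t)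
      exact le_biSup_sq_of_lipschitz hΘc.isBounded (le_max_right K 0) (hK t ω) hθ
    exact h2.integrable one_le_two
  have hpt : ∀ θ ∈ Θ, ∃ L : ℝ,
      Tendsto (fun T : ℕ => ∫ ω, avgLL X g θ T ω ∂μ) atTop (nhds L) ∧
      Tendsto (fun t : ℕ => ∫ ω, ell X g θ t ω ∂μ) atTop (nhds L) ∧
      ∀ᵐ ω ∂μ, Tendsto (fun T : ℕ => avgLL X g θ T ω) atTop (nhds L) := fun θ hθ =>
    tendsto_avgLL_of_finiteMemory hXmeas (hgmeas θ) hErg hlam0 hlam1 (hS1 θ hθ) (hellInt θ hθ)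
  choose! Lbar hL1 hL2 hL3 using hpt
  refine ⟨Lbar, hL1, hL2, ?_⟩
  have hLbar : ∀ θ ∈ Θ, ∀ θ' ∈ Θ, |Lbar θ - Lbar θ'| ≤ max K 0 * dist θ θ' := by
    intro θ hθ θ' hθ'
    refine le_of_tendsto' ((hL2 θ hθ).sub (hL2 θ' hθ')).abs fun t => ?_
    rw [← integral_sub (hellInt θ hθ t) (hellInt θ' hθ' t)]
    have := norm_integral_le_of_norm_le_const (μ := μ)
      (f := fun ω => ell X g θ t ω - ell X g θ' t ω)
      (Eventually.of_forall fun ω => hK t ω θ hθ θ' hθ')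
    simpa using this
  obtain ⟨D, hDΘ, hDc, hD⟩ := hΘc.isSeparable.exists_countable_dense_subset
  filter_upwards [(ae_ball_iff hDc).mpr fun θ hθ => hL3 θ (hDΘ hθ)] with ω hω
  refine hΘc.tendsto_biSup_abs_sub_of_lipschitz hDΘ hD (le_max_right K 0) (fun T => ?_) hLbar hω
  intro θ hθ θ' hθ'
  rw [avgLL, avgLL, ← mul_sub, ← Finset.sum_sub_distrib, abs_mul,
    abs_of_nonneg (by positivity : (0 : ℝ) ≤ (T : ℝ)⁻¹)]
  refine (mul_le_mul_of_nonneg_left ((Finset.abs_sum_le_sum_abs _ _).trans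
    (Finset.sum_le_sum fun t _ => hK t ω θ hθ θ' hθ')) (by positivity)).trans ?_
  rw [Finset.sum_const, Finset.card_range, nsmul_eq_mul, ← mul_assoc]
  exact mul_le_of_le_one_left (by positivity) inv_mul_le_one

end
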